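/- arXiv:2112.03723 — 2 statements merged into one kernel-verified Lean document; each statement's English description precedes it below -/
import Mathlib

section
/- Fix integers B ≥ 1, C ≥ 1 and m ≥ 1. Let y_i ∈ ℝ^C (i = 1,…,B) be one-hot vectors and let a_{j,i} ∈ ℝ^C (j = 1,…,m, i = 1,…,B) be one-hot vectors such that a_{j,i} = y_i for all j and all i ≤ B−1, while a_{j,B} ≠ y_B for every j. Let w ∈ ℝ^m satisfy w_j ≥ 0 for all j and Σ_{j=1}^m w_j = 1, and write f_w(i) = Σ_{k=1}^m w_k a_{k,i}. Then for every j = 1,…,m, the quantity g_j := (2/(BC)) Σ_{i=1}^B ⟨f_w(i) − y_i, a_{j,i}⟩ equals (2/(BC)) ⟨f_w(B), a_{j,B}⟩, and it satisfies g_j ≥ (2/(BC)) w_j ≥ 0. -/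
open scoped BigOperators RealInnerProductSpace

/-- A vector is one-hot if exactly one coordinate equals 1 and all others equal 0. -/
def IsOneHot {C : ℕ} (v : EuclideanSpace ℝ (Fin C)) : Prop :=
  ∃ c : Fin C, v c = 1 ∧ ∀ c' : Fin C, c' ≠ c → v c' = 0

theorem IsOneHot.exists_eq_single {C : ℕ} {v : EuclideanSpace ℝ (Fin C)} (hv : IsOneHot v) :
    ∃ c, v = EuclideanSpace.single c 1 := by
  obtain ⟨c, hc, h⟩ := hv
  refine ⟨c, ?_⟩
  ext i
  by_cases hi : i = c
  · subst hi
    simpa using hc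
  · simp [hi, h i hi]

theorem IsOneHot.inner_self {C : ℕ} {v : EuclideanSpace ℝ (Fin C)} (hv : IsOneHot v) :
    ⟪v, v⟫ = 1 := by
  obtain ⟨c, rfl⟩ := hv.exists_eq_single
  simp

theorem IsOneHot.inner_nonneg {C : ℕ} {u v : EuclideanSpace ℝ (Fin C)} (hu : IsOneHot u)
    (hv : IsOneHot v) : 0 ≤ ⟪u, v⟫ := by
  obtain ⟨c, rfl⟩ := hu.exists_eq_single
  obtain ⟨d, rfl⟩ := hv.exists_eq_single
  by_cases h : c = d <;> simp [EuclideanSpace.inner_single_left, h]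

theorem IsOneHot.inner_eq_zero {C : ℕ} {u v : EuclideanSpace ℝ (Fin C)} (hu : IsOneHot u)
    (hv : IsOneHot v) (huv : u ≠ v) : ⟪u, v⟫ = 0 := by
  obtain ⟨c, rfl⟩ := hu.exists_eq_single
  obtain ⟨d, rfl⟩ := hv.exists_eq_single
  have h : c ≠ d := fun h => huv (h ▸ rfl)
  simp [EuclideanSpace.inner_single_left, h]

/-- If every tree correctly classifies all window points except the new (last)
observation, which every tree misclassifies, then the partial derivative `g_j` of the
batch MSE loss with respect to the weight `w_j` equals `(2/(BC)) ⟪f_w(B), a_{j,B}⟫`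
and satisfies `g_j ≥ (2/(BC)) w_j ≥ 0`. -/
theorem shrub_old_tree_gradient_ge
    (B C m : ℕ) (hB : 1 ≤ B) (hC : 1 ≤ C) (hm : 1 ≤ m)
    (y : Fin B → EuclideanSpace ℝ (Fin C))
    (a : Fin m → Fin B → EuclideanSpace ℝ (Fin C))
    (hy : ∀ i, IsOneHot (y i))
    (ha : ∀ j i, IsOneHot (a j i))
    (iB : Fin B) (hiB : (iB : ℕ) = B - 1)
    (hfit : ∀ (j : Fin m) (i : Fin B), i ≠ iB → a j i = y i)
    (hmiss : ∀ j : Fin m, a j iB ≠ y iB)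
    (w : Fin m → ℝ) (hw0 : ∀ j, 0 ≤ w j) (hw1 : ∑ j, w j = 1) :
    ∀ j : Fin m,
      (2 / ((B : ℝ) * (C : ℝ))) * ∑ i, ⟪(∑ k, w k • a k i) - y i, a j i⟫
          = (2 / ((B : ℝ) * (C : ℝ))) * ⟪(∑ k, w k • a k iB), a j iB⟫ ∧
        (2 / ((B : ℝ) * (C : ℝ))) * ∑ i, ⟪(∑ k, w k • a k i) - y i, a j i⟫
          ≥ (2 / ((B : ℝ) * (C : ℝ))) * w j ∧
        (2 / ((B : ℝ) * (C : ℝ))) * w j ≥ 0 := by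
  intro j
  have hsum : ∑ i, ⟪(∑ k, w k • a k i) - y i, a j i⟫ = ⟪∑ k, w k • a k iB, a j iB⟫ := by
    rw [Finset.sum_eq_single_of_mem iB (Finset.mem_univ _), inner_sub_left,
      (hy iB).inner_eq_zero (ha j iB) (hmiss j).symm, sub_zero]
    intro i _ hi
    have hk : ∑ k, w k • a k i = y i := by
      simp_rw [hfit _ i hi, ← Finset.sum_smul, hw1, one_smul]
    rw [hk, sub_self, inner_zero_left]
  have hle : w j ≤ ⟪∑ k, w k • a k iB, a j iB⟫ := by
    simp_rw [sum_inner, real_inner_smul_left]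
    calc w j = w j * ⟪a j iB, a j iB⟫ := by rw [(ha j iB).inner_self, mul_one]
      _ ≤ _ := Finset.single_le_sum (f := fun k => w k * ⟪a k iB, a j iB⟫)
        (fun k _ => mul_nonneg (hw0 k) ((ha k iB).inner_nonneg (ha j iB))) (Finset.mem_univ j)
  rw [hsum]
  exact ⟨rfl, mul_le_mul_of_nonneg_left hle (by positivity), mul_nonneg (by positivity) (hw0 j)⟩
end

section
/- Fix integers B ≥ 1, C ≥ 1 and m ≥ 1 and a real α ≥ 0. Let y_i ∈ ℝ^C (i = 1,…,B) be one-hot vectors and let a_{j,i} ∈ ℝ^C (j = 1,…,m, i = 1,…,B) be one-hot vectors such that a_{j,i} = y_i for all j and all i ≤ B−1, while a_{j,B} ≠ y_B for every j. Let w ∈ ℝ^m satisfy w_j ≥ 0 for all j and Σ_{j=1}^m w_j = 1, and write f_w(i) = Σ_{k=1}^m w_k a_{k,i}. Define g_j := (2/(BC)) Σ_{i=1}^B ⟨f_w(i) − y_i, a_{j,i}⟩ for j = 1,…,m and g_{m+1} := (2/(BC)) Σ_{i=1}^B ⟨f_w(i) − y_i, y_i⟩, and define u ∈ ℝ^{m+1}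 by u_j = w_j − α·g_j for j ≤ m and u_{m+1} = −α·g_{m+1}. Then Σ_{i=1}^{m+1} u_i ≤ 1. -/
open scoped BigOperators RealInnerProductSpace

theorem IsOneHot.eq_single {C : ℕ} {v : EuclideanSpace ℝ (Fin C)} (hv : IsOneHot v) :
    ∃ c : Fin C, v = EuclideanSpace.single c 1 := by
  obtain ⟨c, hc, h⟩ := hv
  refine ⟨c, ?_⟩
  ext c'
  by_cases hcc : c' = c
  · subst hcc
    simp [hc]
  · simp [h c' hcc, hcc]

theorem IsOneHot.inner_eq_ite {C : ℕ} {v v' : EuclideanSpace ℝ (Fin C)}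
    (hv : IsOneHot v) (hv' : IsOneHot v') [Decidable (v = v')] :
    ⟪v, v'⟫ = if v = v' then 1 else 0 := by
  obtain ⟨c, rfl⟩ := hv.eq_single
  obtain ⟨c', rfl⟩ := hv'.eq_single
  by_cases h : c = c'
  · subst h
    simp
  · have hne : (EuclideanSpace.single c 1 : EuclideanSpace ℝ (Fin C)) ≠
        EuclideanSpace.single c' 1 := by
      intro he
      have := congrArg (fun x : EuclideanSpace ℝ (Fin C) => x c) he
      simp [h] at this
    simp [hne, EuclideanSpace.inner_single_left, h]

/-- The total first-order change of the loss in the directions of all trees is nonnegative at a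
point misclassified by every tree. -/
theorem IsOneHot.sum_inner_residual_nonneg {C : ℕ} {ι : Type*} [Fintype ι]
    {y : EuclideanSpace ℝ (Fin C)} {a : ι → EuclideanSpace ℝ (Fin C)}
    (hy : IsOneHot y) (ha : ∀ j, IsOneHot (a j)) (hne : ∀ j, a j ≠ y)
    {w : ι → ℝ} (hw0 : ∀ j, 0 ≤ w j) (hw1 : ∑ j, w j = 1) :
    0 ≤ ∑ j, ⟪(∑ k, w k • a k) - y, a j⟫ + ⟪(∑ k, w k • a k) - y, y⟫ := by
  classical
  have hay (j : ι) : ⟪a j, y⟫ = 0 := by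
    rw [(ha j).inner_eq_ite hy, if_neg (hne j)]
  have hya (j : ι) : ⟪y, a j⟫ = 0 := by
    rw [real_inner_comm, hay]
  have hyy : ⟪y, y⟫ = 1 := by
    rw [hy.inner_eq_ite hy, if_pos rfl]
  have hone (k : ι) : 1 ≤ ∑ j, ⟪a k, a j⟫ := by
    have hkk : ⟪a k, a k⟫ = 1 := by
      rw [(ha k).inner_eq_ite (ha k), if_pos rfl]
    rw [← hkk]
    refine Finset.single_le_sum (f := fun j => ⟪a k, a j⟫) (fun j _ => ?_) (Finset.mem_univ k)
    change 0 ≤ ⟪a k, a j⟫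
    rw [(ha k).inner_eq_ite (ha j)]
    split_ifs <;> norm_num
  have hsum : 1 ≤ ∑ j, ∑ k, w k * ⟪a k, a j⟫ := by
    rw [Finset.sum_comm, ← hw1]
    refine Finset.sum_le_sum fun k _ => ?_
    rw [← Finset.mul_sum]
    exact le_mul_of_one_le_right (hw0 k) (hone k)
  simp only [inner_sub_left, sum_inner, real_inner_smul_left, hay, hya, hyy, mul_zero, sub_zero,
    Finset.sum_const_zero]
  linarith

/-- After one gradient step with step size `α ≥ 0`, the sum of the `m+1` updated
weights of the Shrub Ensembles algorithm is at most 1. -/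
theorem shrub_updated_weights_sum_le_one
    (B C m : ℕ) (hB : 1 ≤ B) (hC : 1 ≤ C) (hm : 1 ≤ m)
    (α : ℝ) (hα : 0 ≤ α)
    (y : Fin B → EuclideanSpace ℝ (Fin C))
    (a : Fin m → Fin B → EuclideanSpace ℝ (Fin C))
    (hy : ∀ i, IsOneHot (y i))
    (ha : ∀ j i, IsOneHot (a j i))
    (iB : Fin B) (hiB : (iB : ℕ) = B - 1)
    (hfit : ∀ (j : Fin m) (i : Fin B), i ≠ iB → a j i = y i)
    (hmiss : ∀ j : Fin m, a j iB ≠ y iB)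
    (w : Fin m → ℝ) (hw0 : ∀ j, 0 ≤ w j) (hw1 : ∑ j, w j = 1)
    (g : Fin m → ℝ)
    (hg : ∀ j : Fin m,
      g j = (2 / ((B : ℝ) * (C : ℝ))) * ∑ i, ⟪(∑ k, w k • a k i) - y i, a j i⟫)
    (gnew : ℝ)
    (hgnew : gnew = (2 / ((B : ℝ) * (C : ℝ))) * ∑ i, ⟪(∑ k, w k • a k i) - y i, y i⟫)
    (u : Fin (m + 1) → ℝ)
    (hu : ∀ j : Fin m, u j.castSucc = w j - α * g j)
    (hunew : u (Fin.last m) = -(α * gnew)) :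
    ∑ i, u i ≤ 1 := by
  have hres (i : Fin B) (hi : i ≠ iB) : (∑ k, w k • a k i) - y i = 0 := by
    simp only [hfit _ i hi, ← Finset.sum_smul, hw1, one_smul, sub_self]
  have hcollapse (v : Fin B → EuclideanSpace ℝ (Fin C)) :
      ∑ i, ⟪(∑ k, w k • a k i) - y i, v i⟫ = ⟪(∑ k, w k • a k iB) - y iB, v iB⟫ :=
    Finset.sum_eq_single iB (fun i _ hi => by rw [hres i hi, inner_zero_left]) (by simp)
  have hgrad : 0 ≤ ∑ j, g j + gnew := by
    simp only [hg, hgnew, hcollapse]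
    rw [← Finset.mul_sum, ← mul_add]
    exact mul_nonneg (by positivity)
      ((hy iB).sum_inner_residual_nonneg (fun j => ha j iB) hmiss hw0 hw1)
  rw [Fin.sum_univ_castSucc, hunew]
  simp only [hu, Finset.sum_sub_distrib, hw1, ← Finset.mul_sum]
  linarith [mul_nonneg hα hgrad]
end
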